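/- Let ρ_rp(z) = tanh(z) and let w : [0,T) → ℝ^N with T ∈ (0,∞] be any solution of the reparametrized gradient flow with w̃₀ = ρ_rp(w₀) = 0, for A ∈ ℝ^{M×N}, y ∈ ℝ^M, where ρ_link = Id and L satisfies Assumption (A3), and where there exists z̃₀ ∈ ℝ^N with all entries nonzero such that A z̃₀ = y. If the limit w̃_T := lim_{t→T} tanh(w(t)) exists with 𝓛̃(w̃_T) = 0, then g_tanh(w̃_T) = min{ g_tanh(z̃) : z̃ ∈ [−1,1]^N, 𝓛̃(z̃) = 0 }, where g_tanh(z̃) = ⟨z̃, artanh(z̃)⟩ with artanh applied entrywise (extended by continuity to the endpoints ±1). -/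

import Mathlib

open Filter Topology Set
open scoped ENNReal

noncomputable section

/-- Euclidean gradient of `f : ℝ^k → ℝ`: coordinatewise the Fréchet derivative applied to
the standard basis vectors. -/
def grad {k : ℕ} (f : (Fin k → ℝ) → ℝ) (x : Fin k → ℝ) : Fin k → ℝ :=
  fun i => fderiv ℝ f x (Pi.single i 1)

/-- `w` solves the gradient-flow ODE `w' = -∇F(w)` on `[0, T)`, where `T ∈ (0, ∞]` is coded
as an element of `ℝ≥0∞`. -/
def IsGradFlowOn {k : ℕ} (F : (Fin k → ℝ) → ℝ) (T : ℝ≥0∞) (w : ℝ → Fin k → ℝ) : Prop :=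
  ∀ t : ℝ, 0 ≤ t → ENNReal.ofReal t < T →
    HasDerivWithinAt w (-(grad F (w t))) (Set.Ici 0) t

/-- A reparametrized flow is regular if `ρ'` vanishes at some coordinate of `w t` for only
finitely many times `t` in the domain `[0, T)`. -/
def RegularFlow {k : ℕ} (ρ : ℝ → ℝ) (T : ℝ≥0∞) (w : ℝ → Fin k → ℝ) : Prop :=
  {t : ℝ | 0 ≤ t ∧ ENNReal.ofReal t < T ∧ ∃ i, deriv ρ (w t i) = 0}.Finite

/-- The filter of "`t → T` from within `[0,T)`", with `T = ∞` meaning `t → ∞`. -/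
def endFilter (T : ℝ≥0∞) : Filter ℝ :=
  if T = ⊤ then Filter.atTop else nhdsWithin T.toReal (Set.Iio T.toReal)

/-- Entrywise ℓp-norm on `ℝ^k`. -/
def lpNorm {k : ℕ} (p : ℝ) (z : Fin k → ℝ) : ℝ := (∑ i, |z i| ^ p) ^ (1 / p)

/-- Euclidean norm on `ℝ^k`. -/
def euclNorm {k : ℕ} (z : Fin k → ℝ) : ℝ := Real.sqrt (∑ i, (z i) ^ 2)

/-- Bregman divergence associated with `F(z) = ∑ i, H (z i)`, whose gradient is `h = H'`
applied entrywise. -/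
def bregman {k : ℕ} (H h : ℝ → ℝ) (p q : Fin k → ℝ) : ℝ :=
  (∑ i, H (p i)) - (∑ i, H (q i)) - ∑ i, h (q i) * (p i - q i)

/-- Assumption (A3) on the loss function: continuously differentiable, convex in the first
argument, with minimum `0` attained exactly on the diagonal. -/
structure LossA3 {m : ℕ} (L : (Fin m → ℝ) → (Fin m → ℝ) → ℝ) : Prop where
  contDiff : ContDiff ℝ 1 (Function.uncurry L)
  convexOn_fst : ∀ y, ConvexOn ℝ Set.univ fun z => L z y
  nonneg : ∀ z z', 0 ≤ L z z'
  eq_zero_iff : ∀ z z', L z z' = 0 ↔ z = z'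

/-- Assumption (A1) on the link function. -/
structure LinkA1 {m : ℕ} (ρlink : ℝ → ℝ) (y : Fin m → ℝ) : Prop where
  contDiff : ContDiff ℝ 1 ρlink
  injective : Function.Injective ρlink
  mem_image : ∀ j, ∃ x : ℝ, ρlink x = y j

/-- Assumption (A2) on the reparametrization `ρ : ℝ → D` with inverse `ρinv`:
continuously differentiable and invertible, derivative nonzero outside a finite set, and
`([ρ⁻¹]')²` integrable on every compact subset of `D`. -/
structure RepA2 (ρ : ℝ → ℝ) (D : Set ℝ) (ρinv : ℝ → ℝ) : Prop where
  contDiff : ContDiff ℝ 1 ρ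
  mapsTo : ∀ x : ℝ, ρ x ∈ D
  left_inv : ∀ x : ℝ, ρinv (ρ x) = x
  right_inv : ∀ z ∈ D, ρ (ρinv z) = z
  finite_critical : {x : ℝ | deriv ρ x = 0}.Finite
  loc_integrable : ∀ C : Set ℝ, C ⊆ D → IsCompact C →
    MeasureTheory.IntegrableOn (fun z => (deriv ρinv z) ^ 2) C

/-- Inverse hyperbolic tangent on `(-1,1)`. -/
def artanh (x : ℝ) : ℝ := (1 / 2) * Real.log ((1 + x) / (1 - x))

/-- `g_tanh(z) = ⟨z, artanh z⟩`, extended by continuity (with value `+∞`) to the endpoints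
`±1` of `[-1,1]`, as an `EReal`-valued functional. -/
def gtanhE {k : ℕ} (z : Fin k → ℝ) : EReal :=
  ∑ i, if z i ∈ Set.Ioo (-1 : ℝ) 1 then ((z i * artanh (z i) : ℝ) : EReal) else ⊤

/-- The potential `(x + sinh x cosh x) / 2`, a primitive of `cosh ^ 2`. In the coordinate
`z = tanh x` it is the derivative of `z * artanh z / 2`. -/
def tanhPotential (x : ℝ) : ℝ := (x + Real.sinh x * Real.cosh x) / 2

theorem tanhPotential_zero : tanhPotential 0 = 0 := by simp [tanhPotential]

theorem tanhPotential_neg (x : ℝ) : tanhPotential (-x) = -tanhPotential x := by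
  simp only [tanhPotential, Real.sinh_neg, Real.cosh_neg]; ring

theorem continuous_tanhPotential : Continuous tanhPotential := by
  unfold tanhPotential
  exact (continuous_id.add (Real.continuous_sinh.mul Real.continuous_cosh)).div_const 2

theorem hasDerivAt_tanhPotential (x : ℝ) :
    HasDerivAt tanhPotential (Real.cosh x ^ 2) x := by
  have h := ((hasDerivAt_id x).add
    ((Real.hasDerivAt_sinh x).mul (Real.hasDerivAt_cosh x))).div_const 2
  refine h.congr_deriv ?_
  linarith [Real.cosh_sq x]

theorem tendsto_tanhPotential_atTop : Tendsto tanhPotential atTop atTop := by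
  refine tendsto_atTop_mono' atTop ?_ (tendsto_id.atTop_div_const (zero_lt_two' ℝ))
  filter_upwards [eventually_ge_atTop 0] with x hx
  have := mul_nonneg (Real.sinh_nonneg_iff.2 hx) (Real.cosh_pos x).le
  simp only [tanhPotential, id]
  linarith

theorem hasDerivAt_tanh (x : ℝ) : HasDerivAt Real.tanh ((Real.cosh x ^ 2)⁻¹) x := by
  have h := (Real.hasDerivAt_sinh x).div (Real.hasDerivAt_cosh x) (Real.cosh_pos x).ne'
  have e : Real.tanh = Real.sinh / Real.cosh := by
    funext x; simp [Real.tanh_eq_sinh_div_cosh]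
  rw [e]
  refine h.congr_deriv ?_
  rw [← one_div]
  congr 1
  linarith [Real.cosh_sq x]

theorem artanh_eq_real_artanh {x : ℝ} (hx : x ∈ Ioo (-1 : ℝ) 1) : artanh x = Real.artanh x :=
  (Real.artanh_eq_half_log (Ioo_subset_Icc_self hx)).symm

theorem artanh_tanh (x : ℝ) : artanh (Real.tanh x) = x := by
  rw [artanh_eq_real_artanh ⟨Real.neg_one_lt_tanh x, Real.tanh_lt_one x⟩, Real.artanh_tanh]

theorem tanh_artanh {x : ℝ} (hx : x ∈ Ioo (-1 : ℝ) 1) : Real.tanh (artanh x) = x := by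
  rw [artanh_eq_real_artanh hx, Real.tanh_artanh hx]

theorem continuousAt_artanh {x : ℝ} (hx : x ∈ Ioo (-1 : ℝ) 1) : ContinuousAt artanh x := by
  have h1 : (0 : ℝ) < 1 + x := by linarith [hx.1]
  have h2 : (0 : ℝ) < 1 - x := by linarith [hx.2]
  unfold artanh
  exact continuousAt_const.mul (((continuousAt_const.add continuousAt_id).div
    (continuousAt_const.sub continuousAt_id) h2.ne').log (div_pos h1 h2).ne')

theorem lt_of_tanh_lt_tanh {x y : ℝ} (h : Real.tanh x < Real.tanh y) : x < y := by
  simpa only [Real.artanh_tanh] using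
    Real.artanh_lt_artanh (Real.neg_one_lt_tanh x) (Real.tanh_lt_one y) h

theorem tendsto_atTop_of_tanh {α : Type*} {l : Filter α} {u : α → ℝ}
    (h : Tendsto (fun t => Real.tanh (u t)) l (𝓝 1)) : Tendsto u l atTop := by
  refine tendsto_atTop.2 fun b => ?_
  filter_upwards [h.eventually_const_lt (Real.tanh_lt_one b)] with t ht
  exact (lt_of_tanh_lt_tanh ht).le

theorem tendsto_tanhPotential_mul {α : Type*} {l : Filter α} {u : α → ℝ} {p q : ℝ}
    (hq : q ∈ Ioo (-1 : ℝ) 1) (h : Tendsto (fun t => Real.tanh (u t)) l (𝓝 q)) :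
    Tendsto (fun t => (p - q) * tanhPotential (u t)) l
      (𝓝 ((p - q) * tanhPotential (artanh q))) := by
  have h1 := (continuousAt_artanh hq).tendsto.comp h
  have h2 : Tendsto u l (𝓝 (artanh q)) := by
    simpa only [Function.comp_def, artanh_tanh] using h1
  exact ((continuous_tanhPotential.tendsto _).comp h2).const_mul _

theorem tendsto_tanhPotential_mul_atBot {α : Type*} {l : Filter α} {u : α → ℝ} {p q : ℝ}
    (hp : p ∈ Ioo (-1 : ℝ) 1) (hq : q ∈ Icc (-1 : ℝ) 1) (hq' : q ∉ Ioo (-1 : ℝ) 1)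
    (h : Tendsto (fun t => Real.tanh (u t)) l (𝓝 q)) :
    Tendsto (fun t => (p - q) * tanhPotential (u t)) l atBot := by
  have hq1 : q = 1 ∨ q = -1 := by
    by_contra! hne
    exact hq' ⟨lt_of_le_of_ne hq.1 hne.2.symm, lt_of_le_of_ne hq.2 hne.1⟩
  rcases hq1 with rfl | rfl
  · exact (tendsto_tanhPotential_atTop.comp (tendsto_atTop_of_tanh h)).const_mul_atTop_of_neg
      (by linarith [hp.2])
  · have h1 : Tendsto (fun t => Real.tanh (-u t)) l (𝓝 1) := by
      simpa only [Real.tanh_neg, neg_neg] using h.neg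
    have h2 := (tendsto_tanhPotential_atTop.comp
      (tendsto_atTop_of_tanh h1)).const_mul_atTop_of_neg
      (show -(p - -1) < 0 by linarith [hp.1])
    simpa only [Function.comp_def, tanhPotential_neg, neg_mul_neg] using h2

/-- Gradient inequality for the convex function `z * artanh z` in the coordinate `tanh`. -/
theorem mul_tanh_gradient_le (a b : ℝ) :
    b * Real.tanh b + 2 * ((Real.tanh a - Real.tanh b) * tanhPotential b) ≤ a * Real.tanh a := by
  obtain ⟨d, rfl⟩ : ∃ d, a = b + d := ⟨a - b, by ring⟩
  have key : 0 ≤ d * Real.sinh (b + d) - Real.sinh b * Real.sinh d := by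
    have e : d * Real.sinh (b + d) - Real.sinh b * Real.sinh d =
        Real.exp b / 2 * (d * Real.exp d - Real.sinh d)
          + Real.exp (-b) / 2 * (Real.sinh d - d * Real.exp (-d)) := by
      rw [Real.sinh_add]
      simp only [Real.sinh_eq, Real.cosh_eq]
      ring
    have h1 : 0 ≤ d * Real.exp d - Real.sinh d := by
      have := mul_nonneg (Real.exp_pos d).le
        (sub_nonneg.2 (Real.add_one_le_exp (-d + -d)))
      rw [Real.exp_add] at this
      have h3 : Real.exp d * Real.exp (-d) = 1 := by rw [← Real.exp_add]; simp
      rw [Real.sinh_eq]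
      linear_combination (1 / 2) * this + (1 / 2) * Real.exp (-d) * h3
    have h2 : 0 ≤ Real.sinh d - d * Real.exp (-d) := by
      have := mul_nonneg (Real.exp_pos (-d)).le
        (sub_nonneg.2 (Real.add_one_le_exp (d + d)))
      rw [Real.exp_add] at this
      have h3 : Real.exp d * Real.exp (-d) = 1 := by rw [← Real.exp_add]; simp
      rw [Real.sinh_eq]
      linear_combination (1 / 2) * this + (1 / 2) * Real.exp d * h3
    rw [e]
    positivity
  have hc := Real.cosh_pos (b + d)
  have hb := Real.cosh_pos b
  have hs : Real.sinh d = Real.sinh (b + d) * Real.cosh b - Real.cosh (b + d) * Real.sinh b := by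
    rw [← Real.sinh_sub]; congr 1; ring
  have e : (b + d) * Real.tanh (b + d) - (b * Real.tanh b
      + 2 * ((Real.tanh (b + d) - Real.tanh b) * tanhPotential b))
      = (d * Real.sinh (b + d) - Real.sinh b * Real.sinh d) / Real.cosh (b + d) := by
    rw [hs]
    simp only [Real.tanh_eq_sinh_div_cosh, tanhPotential]
    field_simp
    ring
  have := div_nonneg key hc.le
  linarith

theorem gtanhE_eq_coe {k : ℕ} {z : Fin k → ℝ} (hz : ∀ i, z i ∈ Ioo (-1 : ℝ) 1) :
    gtanhE z = ((∑ i, z i * artanh (z i) : ℝ) : EReal) := by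
  unfold gtanhE
  simp only [hz, if_true]
  exact (map_sum (⟨⟨Real.toEReal, EReal.coe_zero⟩, EReal.coe_add⟩ : ℝ →+ EReal) _ _).symm

theorem gtanhE_eq_top {k : ℕ} {z : Fin k → ℝ} {j : Fin k} (hj : z j ∉ Ioo (-1 : ℝ) 1) :
    gtanhE z = ⊤ := by
  unfold gtanhE
  rw [← Finset.add_sum_erase _ _ (Finset.mem_univ j), if_neg hj]
  refine EReal.top_add_of_ne_bot ?_
  refine Finset.sum_induction _ (fun x : EReal => x ≠ ⊥) (fun a b ha hb => ?_)
    EReal.zero_ne_bot fun i _ => ?_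
  · simp [EReal.add_eq_bot_iff, ha, hb]
  · split_ifs
    · exact EReal.coe_ne_bot _
    · exact top_ne_bot

theorem endFilter_neBot (T : ℝ≥0∞) : (endFilter T).NeBot := by
  unfold endFilter
  split_ifs <;> infer_instance

theorem eventually_endFilter {T : ℝ≥0∞} (hT : 0 < T) :
    ∀ᶠ t in endFilter T, 0 ≤ t ∧ ENNReal.ofReal t < T := by
  unfold endFilter
  split_ifs with h
  · subst h
    filter_upwards [eventually_ge_atTop 0] with t ht using ⟨ht, ENNReal.ofReal_lt_top⟩
  · filter_upwards [Ioo_mem_nhdsLT (ENNReal.toReal_pos hT.ne' h)] with t ht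
    exact ⟨ht.1.le, (ENNReal.ofReal_lt_iff_lt_toReal ht.1.le h).2 ht.2⟩

theorem hasFDerivAt_pi_tanh {N : ℕ} (x : Fin N → ℝ) :
    HasFDerivAt (fun z : Fin N → ℝ => fun i => Real.tanh (z i))
      (ContinuousLinearMap.pi fun i =>
        ((Real.cosh (x i) ^ 2)⁻¹) • ContinuousLinearMap.proj (R := ℝ) (φ := fun _ => ℝ) i) x := by
  refine hasFDerivAt_pi.2 fun i => ?_
  have h : HasFDerivAt (fun z : Fin N → ℝ => z i)
      (ContinuousLinearMap.proj (R := ℝ) (φ := fun _ => ℝ) i) x := hasFDerivAt_apply i x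
  exact (hasDerivAt_tanh (x i)).comp_hasFDerivAt x h

/-- The gradient of a function of `A tanh` rescaled by `cosh ^ 2` is orthogonal to `ker A`. -/
theorem sum_mul_cosh_sq_mul_grad {N M : ℕ} {A : Matrix (Fin M) (Fin N) ℝ}
    {G : (Fin M → ℝ) → ℝ} (hG : Differentiable ℝ G) {v : Fin N → ℝ} (hv : A.mulVec v = 0)
    (x : Fin N → ℝ) :
    ∑ i, v i * (Real.cosh (x i) ^ 2 *
      grad (fun z => G (A.mulVec fun i => Real.tanh (z i))) x i) = 0 := by
  set B : (Fin N → ℝ) →L[ℝ] (Fin M → ℝ) := A.mulVecLin.toContinuousLinearMap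
  have hD := ((hG (B fun i => Real.tanh (x i))).hasFDerivAt.comp _
    B.hasFDerivAt).comp x (hasFDerivAt_pi_tanh x)
  have hg : ∀ i, grad (fun z => G (A.mulVec fun i => Real.tanh (z i))) x i =
      (Real.cosh (x i) ^ 2)⁻¹ *
        fderiv ℝ G (B fun i => Real.tanh (x i)) (B (Pi.single i 1)) := by
    intro i
    have e := DFunLike.congr_fun hD.fderiv (Pi.single i 1)
    refine Eq.trans e ?_
    have e2 : (ContinuousLinearMap.pi fun i =>
        ((Real.cosh (x i) ^ 2)⁻¹) • ContinuousLinearMap.proj (R := ℝ) (φ := fun _ => ℝ) i)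
        (Pi.single i (1 : ℝ)) = ((Real.cosh (x i) ^ 2)⁻¹) • Pi.single i (1 : ℝ) := by
      ext j
      by_cases hj : j = i
      · subst hj; simp
      · simp [hj]
    simp only [ContinuousLinearMap.comp_apply]
    rw [e2, map_smul, map_smul, smul_eq_mul]
  calc _ = ∑ i, v i * fderiv ℝ G (B fun i => Real.tanh (x i)) (B (Pi.single i 1)) := by
        refine Finset.sum_congr rfl fun i _ => ?_
        rw [hg, mul_inv_cancel_left₀ (pow_pos (Real.cosh_pos _) 2).ne']
    _ = fderiv ℝ G (B fun i => Real.tanh (x i)) (B (∑ i, v i • Pi.single i (1 : ℝ))) := by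
        simp only [map_sum, map_smul, smul_eq_mul]
    _ = 0 := by
        have hs : ∑ i, v i • (Pi.single i (1 : ℝ) : Fin N → ℝ) = v := by
          ext j
          simp [Finset.sum_apply, Pi.single_apply]
        rw [hs, show B v = 0 from hv, map_zero]

/-- Along the flow started at the origin, `tanhPotential ∘ w` stays orthogonal to `ker A`. -/
theorem IsGradFlowOn.sum_mul_tanhPotential_eq_zero {N M : ℕ} {A : Matrix (Fin M) (Fin N) ℝ}
    {G : (Fin M → ℝ) → ℝ} (hG : Differentiable ℝ G) {T : ℝ≥0∞} {w : ℝ → Fin N → ℝ}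
    (hw0 : ∀ i, w 0 i = 0)
    (hflow : IsGradFlowOn (fun z => G (A.mulVec fun i => Real.tanh (z i))) T w)
    {v : Fin N → ℝ} (hv : A.mulVec v = 0) {t : ℝ} (ht : 0 ≤ t) (htT : ENNReal.ofReal t < T) :
    ∑ i, v i * tanhPotential (w t i) = 0 := by
  have hd : ∀ s ∈ Icc 0 t,
      HasDerivWithinAt (fun s => ∑ i, v i * tanhPotential (w s i)) 0 (Ici 0) s := by
    intro s hs
    have h1 := hflow s hs.1 ((ENNReal.ofReal_le_ofReal hs.2).trans_lt htT)
    have h2 := HasDerivWithinAt.fun_sum fun i (_ : i ∈ Finset.univ) =>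
      ((hasDerivAt_tanhPotential (w s i)).comp_hasDerivWithinAt s
        (hasDerivWithinAt_pi.1 h1 i)).const_mul (v i)
    refine h2.congr_deriv ?_
    simp only [Pi.neg_apply, mul_neg, Finset.sum_neg_distrib,
      sum_mul_cosh_sq_mul_grad hG hv, neg_zero]
  have hc := constant_of_has_deriv_right_zero
    (fun s hs => ((hd s hs).mono Icc_subset_Ici_self).continuousWithinAt)
    (fun s hs => (hd s (Ico_subset_Icc_self hs)).mono (Ici_subset_Ici.2 hs.1))
    t ⟨ht, le_rfl⟩
  simpa [hw0, tanhPotential_zero] using hc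

/-- Implicit bias of `tanh`-reparametrized gradient flow (Corollary). -/
theorem statement15 {N M : ℕ} (A : Matrix (Fin M) (Fin N) ℝ) (y : Fin M → ℝ)
    (L : (Fin M → ℝ) → (Fin M → ℝ) → ℝ) (hA3 : LossA3 L)
    (zt0 : Fin N → ℝ) (hzt0ne : ∀ i, zt0 i ≠ 0) (hzt0 : A.mulVec zt0 = y)
    (T : ℝ≥0∞) (hT : 0 < T) (w : ℝ → Fin N → ℝ)
    (hw0 : ∀ i, Real.tanh (w 0 i) = 0)
    (hflow : IsGradFlowOn (fun z => L (A.mulVec fun i => Real.tanh (z i)) y) T w)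
    (wT : Fin N → ℝ)
    (hlim : Tendsto (fun t => fun i => Real.tanh (w t i)) (endFilter T) (𝓝 wT))
    (hfeas : L (A.mulVec wT) y = 0) :
    (∀ i, wT i ∈ Set.Icc (-1 : ℝ) 1) ∧
    ∀ z : Fin N → ℝ, (∀ i, z i ∈ Set.Icc (-1 : ℝ) 1) → L (A.mulVec z) y = 0 →
      gtanhE wT ≤ gtanhE z := by
  have hG : Differentiable ℝ fun z => L z y :=
    (hA3.contDiff.differentiable one_ne_zero).comp
      (differentiable_id.prodMk (differentiable_const y))
  have hw0' : ∀ i, w 0 i = 0 := fun i => Real.tanh_injective (by rw [hw0 i, Real.tanh_zero])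
  have hlim' := tendsto_pi_nhds.1 hlim
  have := endFilter_neBot T
  have hIcc : ∀ i, wT i ∈ Icc (-1 : ℝ) 1 := fun i =>
    isClosed_Icc.mem_of_tendsto (hlim' i) (Eventually.of_forall fun t =>
      ⟨(Real.neg_one_lt_tanh _).le, (Real.tanh_lt_one _).le⟩)
  refine ⟨hIcc, fun z _ hzL => ?_⟩
  by_cases hzI : ∀ i, z i ∈ Ioo (-1 : ℝ) 1
  swap
  · obtain ⟨j, hj⟩ := not_forall.1 hzI
    rw [gtanhE_eq_top hj]
    exact le_top
  have hv : A.mulVec (z - wT) = 0 := by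
    rw [Matrix.mulVec_sub, (hA3.eq_zero_iff _ _).1 hzL, (hA3.eq_zero_iff _ _).1 hfeas, sub_self]
  have hcons : ∀ᶠ t in endFilter T, ∑ i, (z i - wT i) * tanhPotential (w t i) = 0 := by
    filter_upwards [eventually_endFilter hT] with t ht
    exact hflow.sum_mul_tanhPotential_eq_zero (G := fun z => L z y) hG hw0' hv ht.1 ht.2
  have hwI : ∀ i, wT i ∈ Ioo (-1 : ℝ) 1 := by
    by_contra hne
    obtain ⟨j, hj⟩ := not_forall.1 hne
    have hbdd : ∀ i, ∃ C, ∀ᶠ t in endFilter T, (z i - wT i) * tanhPotential (w t i) ≤ C := by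
      intro i
      by_cases hi : wT i ∈ Ioo (-1 : ℝ) 1
      · exact (tendsto_tanhPotential_mul hi (hlim' i)).isBoundedUnder_le
      · exact ⟨0, (tendsto_tanhPotential_mul_atBot (hzI i) (hIcc i) hi
          (hlim' i)).eventually_le_atBot 0⟩
    choose C hC using hbdd
    obtain ⟨t, ht0, htC, htj⟩ := (hcons.and ((eventually_all.2 hC).and
      ((tendsto_tanhPotential_mul_atBot (hzI j) (hIcc j) hj (hlim' j)).eventually_lt_atBot
        (-∑ i ∈ Finset.univ.erase j, C i)))).exists
    rw [← Finset.add_sum_erase _ _ (Finset.mem_univ j)] at ht0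
    have := Finset.sum_le_sum fun i (_ : i ∈ Finset.univ.erase j) => htC i
    linarith
  have hzero : ∑ i, (z i - wT i) * tanhPotential (artanh (wT i)) = 0 :=
    tendsto_nhds_unique
      (tendsto_finsetSum _ fun i _ => tendsto_tanhPotential_mul (hwI i) (hlim' i))
      (tendsto_const_nhds.congr' (hcons.mono fun t ht => ht.symm))
  rw [gtanhE_eq_coe hwI, gtanhE_eq_coe hzI, EReal.coe_le_coe_iff]
  have hle := Finset.sum_le_sum fun i (_ : i ∈ Finset.univ) =>
    mul_tanh_gradient_le (artanh (z i)) (artanh (wT i))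
  simp only [tanh_artanh (hzI _), tanh_artanh (hwI _), Finset.sum_add_distrib,
    ← Finset.mul_sum, hzero, mul_zero, add_zero] at hle
  simpa only [mul_comm] using hle
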